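/- If B is a finite nonabelian group of order less than 16 whose abelianization is not cyclic of even order, then B is isomorphic to one of: Q(8), D₈, D₁₂, or A₄. -/

import Mathlib

theorem zpow_cast_zmod {G : Type*} [Group G] {n : ℕ} {a : G} (ha : a ^ n = 1) (k : ℤ) :
    a ^ ((k : ZMod n).cast : ℤ) = a ^ k := by
  have h : (((k : ZMod n).cast : ℤ) : ZMod n) = (k : ZMod n) := ZMod.intCast_zmod_cast _
  rw [ZMod.intCast_eq_intCast_iff] at h
  rw [zpow_eq_zpow_iff_modEq]
  exact h.of_dvd (by exact_mod_cast orderOf_dvd_of_pow_eq_one ha)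

theorem zpow_mul_eq_mul_zpow_neg {G : Type*} [Group G] {a s : G} (h : s * a * s⁻¹ = a⁻¹)
    (k : ℤ) : a ^ k * s = s * a ^ (-k) := by
  have h1 : SemiconjBy s a⁻¹ a := by
    simpa using (show SemiconjBy s a a⁻¹ from mul_inv_eq_iff_eq_mul.mp h).inv_right
  have h2 := h1.zpow_right k
  rw [inv_zpow'] at h2
  exact h2.eq.symm

/-- A group of order `2n` generated by an element of order `n` and an involution outside
its powers that inverts it is dihedral. -/
theorem nonempty_mulEquiv_dihedralGroup {G : Type*} [Group G] [Finite G] {n : ℕ} {a s : G}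
    (hG : Nat.card G = 2 * n) (ha : orderOf a = n) (hs : s * s = 1)
    (hsa : s * a * s⁻¹ = a⁻¹) (hmem : s ∉ Subgroup.zpowers a) :
    Nonempty (G ≃* DihedralGroup n) := by
  have han : a ^ n = 1 := ha ▸ pow_orderOf_eq_one a
  have hn : NeZero n := ⟨by have := Nat.card_pos (α := G); omega⟩
  have hc := zpow_cast_zmod han
  have hcomm := zpow_mul_eq_mul_zpow_neg hsa
  let f : DihedralGroup n → G
    | .r i => a ^ (i.cast : ℤ)
    | .sr i => s * a ^ (i.cast : ℤ)
  let F : DihedralGroup n →* G := MonoidHom.mk' f <| by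
    rintro (i | i) (j | j) <;>
      obtain ⟨i, rfl⟩ := ZMod.intCast_surjective i <;>
      obtain ⟨j, rfl⟩ := ZMod.intCast_surjective j <;>
      simp only [f, DihedralGroup.r_mul_r, DihedralGroup.r_mul_sr, DihedralGroup.sr_mul_r,
        DihedralGroup.sr_mul_sr, ← Int.cast_add, ← Int.cast_sub, hc]
    · rw [zpow_add]
    · rw [← mul_assoc, hcomm, mul_assoc, ← zpow_add, neg_add_eq_sub]
    · rw [mul_assoc, ← zpow_add]
    · rw [mul_assoc, ← mul_assoc _ s, hcomm, mul_assoc, ← zpow_add, ← mul_assoc, hs, one_mul,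
        neg_add_eq_sub]
  have hF : Function.Injective F := by
    rw [injective_iff_map_eq_one]
    rintro (i | i) h <;> obtain ⟨i, rfl⟩ := ZMod.intCast_surjective i
    · replace h : a ^ (((i : ZMod n)).cast : ℤ) = 1 := h
      rw [hc, ← orderOf_dvd_iff_zpow_eq_one, ha, ← ZMod.intCast_zmod_eq_zero_iff_dvd] at h
      rw [h, DihedralGroup.one_def]
    · replace h : s * a ^ (((i : ZMod n)).cast : ℤ) = 1 := h
      refine absurd ?_ hmem
      rw [eq_inv_of_mul_eq_one_left h]
      exact inv_mem (Subgroup.zpow_mem_zpowers _ _)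
  refine ⟨(MulEquiv.ofBijective F ((Nat.bijective_iff_injective_and_card F).mpr ⟨hF, ?_⟩)).symm⟩
  rw [hG, DihedralGroup.nat_card]

/-- A group of order `4n` generated by an element `a` of order `2n` and an element outside
its powers that inverts it and squares to `a ^ n` is generalized quaternion. -/
theorem nonempty_mulEquiv_quaternionGroup {G : Type*} [Group G] [Finite G] {n : ℕ} {a x : G}
    (hG : Nat.card G = 4 * n) (ha : orderOf a = 2 * n) (hx : x * x = a ^ n)
    (hxa : x * a * x⁻¹ = a⁻¹) (hmem : x ∉ Subgroup.zpowers a) :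
    Nonempty (G ≃* QuaternionGroup n) := by
  have han : a ^ (2 * n) = 1 := ha ▸ pow_orderOf_eq_one a
  have hn : NeZero n := ⟨by have := Nat.card_pos (α := G); omega⟩
  have hc := zpow_cast_zmod han
  have hcomm := zpow_mul_eq_mul_zpow_neg hxa
  let f : QuaternionGroup n → G
    | .a i => a ^ (i.cast : ℤ)
    | .xa i => x * a ^ (i.cast : ℤ)
  let F : QuaternionGroup n →* G := MonoidHom.mk' f <| by
    rintro (i | i) (j | j) <;>
      obtain ⟨i, rfl⟩ := ZMod.intCast_surjective i <;>
      obtain ⟨j, rfl⟩ := ZMod.intCast_surjective j <;>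
      simp only [f, QuaternionGroup.a_mul_a, QuaternionGroup.a_mul_xa, QuaternionGroup.xa_mul_a,
        QuaternionGroup.xa_mul_xa, ← Int.cast_add, ← Int.cast_sub, ← Int.cast_natCast (R := ZMod _) n,
        hc]
    · rw [zpow_add]
    · rw [← mul_assoc, hcomm, mul_assoc, ← zpow_add, neg_add_eq_sub]
    · rw [mul_assoc, ← zpow_add]
    · rw [mul_assoc, ← mul_assoc _ x, hcomm, mul_assoc, ← zpow_add, ← mul_assoc, hx,
        ← zpow_natCast, ← zpow_add, neg_add_eq_sub, add_sub_assoc]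
  have hF : Function.Injective F := by
    rw [injective_iff_map_eq_one]
    rintro (i | i) h <;> obtain ⟨i, rfl⟩ := ZMod.intCast_surjective i
    · replace h : a ^ (((i : ZMod (2 * n))).cast : ℤ) = 1 := h
      rw [hc, ← orderOf_dvd_iff_zpow_eq_one, ha, ← ZMod.intCast_zmod_eq_zero_iff_dvd] at h
      rw [h, QuaternionGroup.one_def]
    · replace h : x * a ^ (((i : ZMod (2 * n))).cast : ℤ) = 1 := h
      refine absurd ?_ hmem
      rw [eq_inv_of_mul_eq_one_left h]
      exact inv_mem (Subgroup.zpow_mem_zpowers _ _)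
  refine ⟨(MulEquiv.ofBijective F ((Nat.bijective_iff_injective_and_card F).mpr ⟨hF, ?_⟩)).symm⟩
  rw [hG, Nat.card_eq_fintype_card, QuaternionGroup.card]

theorem commutator_ne_bot_of_not_comm {G : Type*} [Group G] (h : ¬ ∀ x y : G, x * y = y * x) :
    commutator G ≠ ⊥ := by
  intro hbot
  refine h fun x y => ?_
  have hxy := Subgroup.commutator_mem_commutator (Subgroup.mem_top x) (Subgroup.mem_top y)
  rw [← commutator_def, hbot, Subgroup.mem_bot] at hxy
  exact commutatorElement_eq_one_iff_mul_comm.mp hxy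

theorem commutator_le_of_prime_index {G : Type*} [Group G] {N : Subgroup G} [N.Normal]
    (h : N.index.Prime) : commutator G ≤ N := by
  have : Fact N.index.Prime := ⟨h⟩
  have hcyc : IsCyclic (G ⧸ N) := isCyclic_of_prime_card (p := N.index) rfl
  rw [← Subgroup.Normal.quotient_commutative_iff_commutator_le]
  infer_instance

/-- If the commutator subgroup of a nonabelian group lies in a subgroup of prime order, then
they agree. -/
theorem commutator_eq_of_prime_card {G : Type*} [Group G]
    (hna : ¬ ∀ x y : G, x * y = y * x) {N : Subgroup G} (hN : (Nat.card N).Prime)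
    (hle : commutator G ≤ N) : commutator G = N := by
  have : Finite N := Nat.finite_of_card_ne_zero hN.ne_zero
  rcases hN.eq_one_or_self_of_dvd _ (Subgroup.card_dvd_of_le hle) with h | h
  · exact absurd (Subgroup.card_eq_one.mp h) (commutator_ne_bot_of_not_comm hna)
  · exact Subgroup.eq_of_le_of_card_ge hle h.ge

theorem exists_subgroup_card_eq_prime {G : Type*} [Group G] [Finite G] {p : ℕ} (hp : p.Prime)
    (h : p ∣ Nat.card G) : ∃ P : Subgroup G, Nat.card P = p := by
  have : Fact p.Prime := ⟨hp⟩
  obtain ⟨a, ha⟩ := exists_prime_orderOf_dvd_card' p h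
  exact ⟨Subgroup.zpowers a, by rw [Nat.card_zpowers, ha]⟩

theorem abelianization_of_card_eq_two_mul_prime {G : Type*} [Group G] [Finite G] {p : ℕ}
    (hp : p.Prime) (hG : Nat.card G = 2 * p) (hna : ¬ ∀ x y : G, x * y = y * x) :
    IsCyclic (Abelianization G) ∧ Even (Nat.card (Abelianization G)) := by
  obtain ⟨P, hP⟩ := exists_subgroup_card_eq_prime hp (hG ▸ dvd_mul_left p 2)
  have hidx : P.index = 2 := by
    have := P.index_mul_card
    rw [hP, hG] at this
    exact Nat.eq_of_mul_eq_mul_right hp.pos this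
  have : P.Normal := Subgroup.normal_of_index_eq_two hidx
  have hc := commutator_eq_of_prime_card hna (hP ▸ hp)
    (commutator_le_of_prime_index (hidx ▸ Nat.prime_two))
  have hcard : Nat.card (Abelianization G) = 2 := by
    change (commutator G).index = 2
    rw [hc, hidx]
  exact ⟨isCyclic_of_prime_card hcard, hcard ▸ even_two⟩

theorem mul_comm_of_card_eq_fifteen {G : Type*} [Group G] [Finite G] (hG : Nat.card G = 15)
    (x y : G) : x * y = y * x := by
  revert x y
  by_contra hna
  obtain ⟨P, hP⟩ := exists_subgroup_card_eq_prime (G := G) Nat.prime_five (by omega)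
  have hPi : P.index = 3 := by have := P.index_mul_card; rw [hP, hG] at this; omega
  have : P.Normal := Subgroup.normal_of_index_eq_minFac_card (by rw [hPi, hG]; norm_num)
  have hcP := commutator_eq_of_prime_card hna (hP ▸ Nat.prime_five)
    (commutator_le_of_prime_index (hPi ▸ Nat.prime_three))
  have : Fact (Nat.Prime 3) := ⟨Nat.prime_three⟩
  let Q : Sylow 3 G := default
  have hQ : Nat.card Q = 3 := by
    rw [Q.card_eq_multiplicity, hG, Nat.factorization_def _ Nat.prime_three]
    have : padicValNat 3 (3 * 5) = 1 := by
      rw [padicValNat.mul (by norm_num) (by norm_num), padicValNat_self,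
        padicValNat.eq_zero_of_not_dvd (by norm_num)]
    rw [show 15 = 3 * 5 from rfl, this]; rfl
  have hQi : (Q : Subgroup G).index = 5 := by
    have := (Q : Subgroup G).index_mul_card; rw [hQ, hG] at this; omega
  have hn1 : Nat.card (Sylow 3 G) = 1 := by
    have h1 := card_sylow_modEq_one 3 G
    have h2 := Q.card_dvd_index
    rw [hQi, Nat.dvd_prime Nat.prime_five] at h2
    rcases h2 with h2 | h2
    · exact h2
    · rw [h2] at h1; exact absurd h1 (by decide)
  have : Subsingleton (Sylow 3 G) := (Nat.card_eq_one_iff_unique.mp hn1).1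
  have : (Q : Subgroup G).Normal := Sylow.normal_of_subsingleton Q
  have hcQ := commutator_eq_of_prime_card hna (N := Q)
    (by rw [show Nat.card (Q : Subgroup G) = 3 from hQ]; exact Nat.prime_three)
    (commutator_le_of_prime_index (hQi ▸ Nat.prime_five))
  have : Nat.card P = Nat.card Q := by rw [← hcP, hcQ]
  omega

theorem exists_orderOf_eq_four {G : Type*} [Group G] [Finite G] (hG : Nat.card G = 8)
    (hna : ¬ ∀ x y : G, x * y = y * x) : ∃ a b : G, orderOf a = 4 ∧ a * b ≠ b * a := by
  have key : ∀ a b : G, a * a ≠ 1 → a * b ≠ b * a → orderOf a = 4 := by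
    intro a b ha hab
    have hd : orderOf a ∣ 2 ^ 3 := by
      simpa [hG] using orderOf_dvd_natCard a
    obtain ⟨k, hk, hok⟩ := (Nat.dvd_prime_pow Nat.prime_two).mp hd
    have hle : ¬ k ≤ 1 := fun hk1 => ha <| by
      rw [← pow_two]
      exact orderOf_dvd_iff_pow_eq_one.mp (hok ▸ pow_dvd_pow 2 hk1)
    have hne : k ≠ 3 := by
      rintro rfl
      have := isCyclic_of_orderOf_eq_card a (by rw [hok, hG]; rfl)
      exact hab (IsCyclic.isMulCommutative.is_comm.comm a b)
    obtain rfl : k = 2 := by omega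
    simpa using hok
  obtain ⟨x, hx⟩ := not_forall.mp hna
  obtain ⟨y, hxy⟩ := not_forall.mp hx
  by_cases hx2 : x * x = 1
  · by_cases hy2 : y * y = 1
    · have h1 : (x * y) * (x * y) ≠ 1 := fun h => hxy <| by
        rw [eq_inv_of_mul_eq_one_left h, mul_inv_rev, inv_eq_of_mul_eq_one_left hx2,
          inv_eq_of_mul_eq_one_left hy2]
      have h2 : (x * y) * x ≠ x * (x * y) := fun h => hxy <| by
        rw [mul_assoc] at h
        exact (mul_left_cancel h).symm
      exact ⟨x * y, x, key _ _ h1 h2, h2⟩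
    · exact ⟨y, x, key _ _ hy2 (Ne.symm hxy), Ne.symm hxy⟩
  · exact ⟨x, y, key _ _ hx2 hxy, hxy⟩

/-- A nonabelian group of order eight is quaternion or dihedral. -/
theorem quaternion_or_dihedral_of_card_eq_eight {G : Type*} [Group G] [Finite G]
    (hG : Nat.card G = 8) (hna : ¬ ∀ x y : G, x * y = y * x) :
    Nonempty (G ≃* QuaternionGroup 2) ∨ Nonempty (G ≃* DihedralGroup 4) := by
  obtain ⟨a, b, ha, hab⟩ := exists_orderOf_eq_four hG hna
  have hidx : (Subgroup.zpowers a).index = 2 := by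
    have := (Subgroup.zpowers a).index_mul_card
    rw [Nat.card_zpowers, ha, hG] at this; omega
  have hN : (Subgroup.zpowers a).Normal := Subgroup.normal_of_index_eq_two hidx
  have ha4 : a ^ 4 = 1 := ha ▸ pow_orderOf_eq_one a
  have ha2 : a ^ 2 ≠ 1 := fun h => by
    have := Nat.le_of_dvd two_pos (orderOf_dvd_of_pow_eq_one h); omega
  have hmem : ∀ g ∈ Subgroup.zpowers a, g = 1 ∨ g = a ∨ g = a ^ 2 ∨ g = a⁻¹ := by
    classical
    intro g hg
    rw [mem_zpowers_iff_mem_range_orderOf, ha] at hg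
    have h3 : a ^ 3 = a⁻¹ := eq_inv_of_mul_eq_one_left (by rw [← pow_succ, ha4])
    simp only [Finset.mem_image, Finset.mem_range] at hg
    obtain ⟨k, hk, rfl⟩ := hg
    interval_cases k <;> simp [h3]
  have hb : b ∉ Subgroup.zpowers a := fun h => by
    obtain ⟨k, rfl⟩ := Subgroup.mem_zpowers_iff.mp h
    exact hab (Commute.self_zpow a k)
  have hconj : b * a * b⁻¹ = a⁻¹ := by
    rcases hmem _ (hN.conj_mem a (Subgroup.mem_zpowers a) b) with h | h | h | h
    · rw [conj_eq_one_iff] at h; exact absurd (by rw [h, one_pow]) ha2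
    · exact absurd (mul_inv_eq_iff_eq_mul.mp h).symm hab
    · have h2 : (b * a * b⁻¹) ^ 2 = 1 := by rw [h, ← pow_mul, ha4]
      rw [conj_pow, conj_eq_one_iff] at h2
      exact absurd h2 ha2
    · exact h
  have hbb : Commute (b * b) b := (Commute.refl b).mul_left (Commute.refl b)
  rcases hmem _ (Subgroup.mul_self_mem_of_index_two hidx b) with h | h | h | h
  · exact Or.inr (nonempty_mulEquiv_dihedralGroup hG ha h hconj hb)
  · exact absurd (h ▸ hbb).eq hab
  · exact Or.inl (nonempty_mulEquiv_quaternionGroup hG ha h hconj hb)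
  · rw [h] at hbb
    exact absurd (Commute.inv_left_iff.mp hbb).eq hab

/-- A group of order twelve with a non-normal subgroup of order three is `A₄`. -/
theorem nonempty_mulEquiv_alternatingGroup_of_not_normal {G : Type*} [Group G] [Finite G]
    (hG : Nat.card G = 12) {P : Subgroup G} (hP : Nat.card P = 3) (hn : ¬ P.Normal) :
    Nonempty (G ≃* alternatingGroup (Fin 4)) := by
  have hcore : P.normalCore = ⊥ := by
    rcases Nat.prime_three.eq_one_or_self_of_dvd _
      (hP ▸ Subgroup.card_dvd_of_le P.normalCore_le) with h | h
    · exact Subgroup.card_eq_one.mp h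
    · have := Subgroup.eq_of_le_of_card_ge P.normalCore_le (by rw [h, hP])
      exact absurd (this ▸ P.normalCore_normal) hn
  have hidx : Nat.card (G ⧸ P) = Nat.card (Fin 4) := by
    have := P.index_mul_card
    rw [hP, hG, Subgroup.index] at this
    rw [Nat.card_fin]; omega
  obtain ⟨e⟩ : Nonempty (G ⧸ P ≃ Fin 4) := Finite.card_eq.mp hidx
  let f : G →* Equiv.Perm (Fin 4) :=
    (e.permCongrHom.toMonoidHom).comp (MulAction.toPermHom G (G ⧸ P))
  have hf : Function.Injective f := by
    refine e.permCongrHom.injective.comp ?_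
    rw [← MonoidHom.ker_eq_bot_iff, ← Subgroup.normalCore_eq_ker, hcore]
  have e1 := MonoidHom.ofInjective hf
  have hr : f.range.index = 2 := by
    have := f.range.index_mul_card
    rw [← Nat.card_congr e1.toEquiv, hG, Nat.card_perm, Nat.card_fin,
      show Nat.factorial 4 = 24 from rfl] at this
    omega
  exact ⟨e1.trans (MulEquiv.subgroupCongr (Equiv.Perm.eq_alternatingGroup_of_index_eq_two hr))⟩

/-- A nonabelian group of order twelve with a normal subgroup of order three and noncyclic
abelianization is dihedral. -/
theorem nonempty_mulEquiv_dihedralGroup_of_normal {G : Type*} [Group G] [Finite G]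
    (hG : Nat.card G = 12) (hna : ¬ ∀ x y : G, x * y = y * x)
    {P : Subgroup G} (hP : Nat.card P = 3) [P.Normal]
    (hab : ¬ (IsCyclic (Abelianization G) ∧ Even (Nat.card (Abelianization G)))) :
    Nonempty (G ≃* DihedralGroup 6) := by
  have : Fact (Nat.Prime 2) := ⟨Nat.prime_two⟩
  have : Fact (Nat.Prime 3) := ⟨Nat.prime_three⟩
  have hPi : P.index = 4 := by have := P.index_mul_card; rw [hP, hG] at this; omega
  have hle : commutator G ≤ P := by
    rw [← Subgroup.Normal.quotient_commutative_iff_commutator_le]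
    exact IsPGroup.isMulCommutative_of_card_eq_prime_sq (p := 2) hPi
  have hcP := commutator_eq_of_prime_card hna (hP ▸ Nat.prime_three) hle
  have hA : Nat.card (Abelianization G) = 4 := by
    change (commutator G).index = 4
    rw [hcP, hPi]
  have hsq : ∀ g : G, g ^ 2 ∈ P := by
    intro g
    have hd : orderOf (Abelianization.of g) ∣ 2 ^ 2 := by
      simpa [hA] using orderOf_dvd_natCard (Abelianization.of g)
    obtain ⟨k, hk, hok⟩ := (Nat.dvd_prime_pow Nat.prime_two).mp hd
    have hk2 : k ≠ 2 := by
      rintro rfl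
      exact hab ⟨isCyclic_of_orderOf_eq_card (Abelianization.of g) (by rw [hok, hA]; rfl),
        hA ▸ by decide⟩
    have h1 : Abelianization.of g ^ 2 = 1 :=
      orderOf_dvd_iff_pow_eq_one.mp (hok ▸ pow_dvd_pow 2 (by omega : k ≤ 1))
    rw [← map_pow, ← MonoidHom.mem_ker, Abelianization.ker_of, hcP] at h1
    exact h1
  obtain ⟨V, hV⟩ := Sylow.exists_subgroup_card_pow_prime (G := G) 2 (n := 2) (by rw [hG]; decide)
  have hdisj : ∀ g ∈ P, g ∈ V → g = 1 := by
    intro g hgP hgV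
    have h3 := Subgroup.orderOf_dvd_natCard P hgP
    have h4 := Subgroup.orderOf_dvd_natCard V hgV
    rw [hP] at h3; rw [hV] at h4
    exact orderOf_eq_one_iff.mp (Nat.eq_one_of_dvd_coprimes (by decide) h3 h4)
  have hVsq : ∀ v ∈ V, v * v = 1 := fun v hv =>
    hdisj _ (pow_two v ▸ hsq v) (V.mul_mem hv hv)
  have hVinv : ∀ v ∈ V, v⁻¹ = v := fun v hv => inv_eq_of_mul_eq_one_left (hVsq v hv)
  have hVcomm : ∀ v ∈ V, ∀ w ∈ V, Commute v w := fun v hv w hw => by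
    have := hVinv _ (V.mul_mem hv hw)
    rw [mul_inv_rev, hVinv v hv, hVinv w hw] at this
    exact this.symm
  obtain ⟨⟨c, hcmem⟩, hc⟩ := exists_prime_orderOf_dvd_card' (G := P) 3 (by rw [hP])
  rw [Subgroup.orderOf_mk] at hc
  have hPc : Subgroup.zpowers c = P := Subgroup.eq_of_le_of_card_ge
    (Subgroup.zpowers_le.mpr hcmem) (by rw [Nat.card_zpowers, hc, hP])
  have hc3 : c ^ 3 = 1 := hc ▸ pow_orderOf_eq_one c
  have hc1 : c ≠ 1 := by rintro rfl; simp at hc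
  have hPmem : ∀ g ∈ P, g = 1 ∨ g = c ∨ g = c⁻¹ := by
    classical
    intro g hg
    rw [← hPc, mem_zpowers_iff_mem_range_orderOf, hc] at hg
    have h2 : c ^ 2 = c⁻¹ := eq_inv_of_mul_eq_one_left (by rw [← pow_succ, hc3])
    simp only [Finset.mem_image, Finset.mem_range] at hg
    obtain ⟨k, hk, rfl⟩ := hg
    interval_cases k <;> simp [h2]
  have hconj : ∀ g : G, Commute g c ∨ g * c * g⁻¹ = c⁻¹ := by
    intro g
    rcases hPmem _ (Subgroup.Normal.conj_mem ‹_› c hcmem g) with h | h | h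
    · exact absurd (conj_eq_one_iff.mp h) hc1
    · exact Or.inl (mul_inv_eq_iff_eq_mul.mp h)
    · exact Or.inr h
  have htop : ∀ H : Subgroup G, P ≤ H → V ≤ H → H = ⊤ := by
    intro H h1 h2
    refine Subgroup.eq_top_of_card_eq H (Nat.dvd_antisymm (Subgroup.card_subgroup_dvd_card H) ?_)
    rw [hG]
    have h3 := Subgroup.card_dvd_of_le h1
    have h4 := Subgroup.card_dvd_of_le h2
    rw [hP] at h3; rw [hV] at h4
    exact Nat.Coprime.mul_dvd_of_dvd_of_dvd (m := 3) (n := 4) (by decide) h3 h4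
  obtain ⟨s, hsV, hsc⟩ : ∃ s ∈ V, ¬ Commute s c := by
    by_contra! hall
    have hPcomm : ∀ g : G, (∀ v ∈ V, Commute g v) → Commute g c → ∀ x, Commute g x := by
      intro g h1 h2 x
      have : Subgroup.centralizer {g} = ⊤ := htop _
        (hPc ▸ Subgroup.zpowers_le.mpr (Subgroup.mem_centralizer_singleton_iff.mpr h2.eq.symm))
        (fun v hv => Subgroup.mem_centralizer_singleton_iff.mpr (h1 v hv).eq.symm)
      exact (Subgroup.mem_centralizer_singleton_iff.mp (this ▸ Subgroup.mem_top x)).symm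
    have hcc := hPcomm c (fun v hv => (hall v hv).symm) (Commute.refl c)
    have hcen : Subgroup.center G = ⊤ := htop _
      (hPc ▸ Subgroup.zpowers_le.mpr
        (Subgroup.mem_center_iff.mpr fun x => (hcc x).eq.symm))
      (fun v hv => Subgroup.mem_center_iff.mpr fun x =>
        (hPcomm v (hVcomm v hv) (hall v hv) x).eq.symm)
    exact hna fun x y => Subgroup.mem_center_iff.mp (hcen ▸ Subgroup.mem_top y) x
  have hs1 : s ≠ 1 := by rintro rfl; exact hsc (Commute.one_left c)
  have hsc' : s * c * s⁻¹ = c⁻¹ := (hconj s).resolve_left hsc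
  obtain ⟨z, hzV, hz1, hzc⟩ : ∃ z ∈ V, z ≠ 1 ∧ Commute z c := by
    obtain ⟨t, htV, ht1, hts⟩ : ∃ t ∈ V, t ≠ 1 ∧ t ≠ s := by
      by_contra! hall
      have hsub : (V : Set G) ⊆ {1, s} := fun t ht => by
        by_cases h : t = 1
        · exact Or.inl h
        · exact Or.inr (hall t ht h)
      have := (Set.ncard_le_ncard hsub).trans (Set.ncard_insert_le _ _)
      rw [Set.ncard_singleton, ← Nat.card_coe_set_eq] at this
      change Nat.card V ≤ _ at this
      omega
    rcases hconj t with h | h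
    · exact ⟨t, htV, ht1, h⟩
    · refine ⟨s * t, V.mul_mem hsV htV, fun h1 => hts ?_, ?_⟩
      · rw [← hVinv s hsV]; exact eq_inv_of_mul_eq_one_right h1
      · refine mul_inv_eq_iff_eq_mul.mp ?_
        calc s * t * c * (s * t)⁻¹ = s * (t * c * t⁻¹) * s⁻¹ := by group
          _ = (s * c * s⁻¹)⁻¹ := by rw [h]; group
          _ = c := by rw [hsc', inv_inv]
  have hz : orderOf z = 2 := orderOf_eq_prime (by rw [pow_two, hVsq z hzV]) hz1
  have ho : orderOf (z * c) = 6 := by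
    rw [hzc.orderOf_mul_eq_mul_orderOf_of_coprime (by rw [hz, hc]; decide), hz, hc]
  have hsz : Commute s z := hVcomm s hsV z hzV
  refine nonempty_mulEquiv_dihedralGroup hG ho (hVsq s hsV) ?_ ?_
  · calc s * (z * c) * s⁻¹ = (s * z * s⁻¹) * (s * c * s⁻¹) := by group
      _ = z⁻¹ * c⁻¹ := by rw [hsc', hsz.eq, mul_inv_cancel_right, hVinv z hzV]
      _ = (z * c)⁻¹ := by rw [hzc.eq, mul_inv_rev]
  · intro hmem
    obtain ⟨k, rfl⟩ := Subgroup.mem_zpowers_iff.mp hmem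
    exact hsc ((hzc.mul_left (Commute.refl c)).zpow_left k)


/-- Any finite nonabelian group of order less than 16 whose abelianization is not
cyclic of even order is isomorphic to Q(8), D₈, D₁₂ or A₄. -/
theorem stmt9 (B : Type*) [Group B] [Finite B]
    (hcard : Nat.card B < 16)
    (hnonab : ¬ ∀ x y : B, x * y = y * x)
    (hab : ¬ (IsCyclic (Abelianization B) ∧ Even (Nat.card (Abelianization B)))) :
    Nonempty (B ≃* QuaternionGroup 2) ∨ Nonempty (B ≃* DihedralGroup 4) ∨
    Nonempty (B ≃* DihedralGroup 6) ∨ Nonempty (B ≃* alternatingGroup (Fin 4)) := by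
  have hp : ∀ p : ℕ, p.Prime → Nat.card B ≠ p := fun p hp h => hnonab fun x y => by
    have : Fact p.Prime := ⟨hp⟩
    have := isCyclic_of_prime_card h
    exact IsCyclic.isMulCommutative.is_comm.comm x y
  have hp2 : ∀ p : ℕ, p.Prime → Nat.card B ≠ p ^ 2 := fun p hp h => hnonab fun x y => by
    have : Fact p.Prime := ⟨hp⟩
    exact (IsPGroup.isMulCommutative_of_card_eq_prime_sq h).is_comm.comm x y
  have h2p : ∀ p : ℕ, p.Prime → Nat.card B ≠ 2 * p := fun p hp h =>
    hab (abelianization_of_card_eq_two_mul_prime hp h hnonab)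
  have hpos : 0 < Nat.card B := Nat.card_pos
  have h1 : Nat.card B ≠ 1 := fun h => hnonab fun x y => by
    have := (Nat.card_eq_one_iff_unique.mp h).1
    exact Subsingleton.elim _ _
  have h15 : Nat.card B ≠ 15 := fun h => hnonab (mul_comm_of_card_eq_fifteen h)
  have hcases : Nat.card B = 8 ∨ Nat.card B = 12 := by
    have := hp 2 (by norm_num)
    have := hp 3 (by norm_num)
    have := hp 5 (by norm_num)
    have := hp 7 (by norm_num)
    have := hp 11 (by norm_num)
    have := hp 13 (by norm_num)
    have := hp2 2 (by norm_num)
    have := hp2 3 (by norm_num)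
    have := h2p 3 (by norm_num)
    have := h2p 5 (by norm_num)
    have := h2p 7 (by norm_num)
    omega
  rcases hcases with h | h
  · rcases quaternion_or_dihedral_of_card_eq_eight h hnonab with h | h
    · exact Or.inl h
    · exact Or.inr (Or.inl h)
  · obtain ⟨P, hP⟩ := exists_subgroup_card_eq_prime (G := B) Nat.prime_three (by rw [h]; decide)
    by_cases hn : P.Normal
    · exact Or.inr (Or.inr (Or.inl (nonempty_mulEquiv_dihedralGroup_of_normal h hnonab hP hab)))
    · exact Or.inr (Or.inr (Or.inr (nonempty_mulEquiv_alternatingGroup_of_not_normal h hP hn)))
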